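/- Let w be an infinite LSP word and f an R-bLSP morphism defined exactly on alph(w). The following are equivalent: (1) f(w) is not LSP; (2) there exist pairwise distinct letters a, b, c such that w is (a,b,c)-fragile and the longest common prefix of f(b) and f(c) is strictly longer than the longest common prefix of f(a) and f(b); (3) there exist pairwise distinct letters a, b, c in w such that w is (a,b,c)-fragile and f is LSP (a,b,c)-breaking. -/

import Mathlib

section LSPDefs

variable {A : Type*} {B : Type*}

/-- `u` is a prefix of the infinite word `w`. -/
def IsPrefixI (u : List A) (w : ℕ → A) : Prop :=
  ∀ (i : ℕ) (h : i < u.length), u.get ⟨i, h⟩ = w i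

/-- `u` is a factor of the infinite word `w`. -/
def IsFactorI (u : List A) (w : ℕ → A) : Prop :=
  ∃ k : ℕ, ∀ (i : ℕ) (h : i < u.length), u.get ⟨i, h⟩ = w (k + i)

/-- `u` is a left special factor of the infinite word `w`. -/
def LeftSpecialI (u : List A) (w : ℕ → A) : Prop :=
  ∃ a b : A, a ≠ b ∧ IsFactorI (a :: u) w ∧ IsFactorI (b :: u) w

/-- An infinite word is LSP if all its left special factors are prefixes of it. -/
def IsLSP (w : ℕ → A) : Prop :=
  ∀ u : List A, LeftSpecialI u w → IsPrefixI u w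

/-- Application of a morphism (given by images of letters) to a finite word. -/
def applyM (f : A → List B) (u : List A) : List B := (u.map f).flatten

/-- The prefix of length `n` of an infinite word. -/
def infPrefix (w : ℕ → A) (n : ℕ) : List A := List.ofFn (fun i : Fin n => w i)

/-- `x` is the image of the infinite word `w` under the morphism `f`. -/
def InfImage (f : A → List B) (w : ℕ → A) (x : ℕ → B) : Prop :=
  ∀ n : ℕ, IsPrefixI (applyM f (infPrefix w n)) x

/-- `f` is a basic LSP (bLSP) endomorphism. -/
def IsBLSP (f : A → List A) : Prop :=
  ∃ α : A, f α = [α] ∧ ∀ β : A, β ≠ α → ∃ γ : A, f β = f γ ++ [β]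

/-- `f` is an R-bLSP morphism with domain alphabet `D`: the restriction to `D` of a
bLSP morphism `g` (letters outside the domain are sent to `[]`). -/
def IsRBLSPOn (D : Set A) (f : A → List A) : Prop :=
  (∀ x : A, x ∈ D ↔ f x ≠ []) ∧ ∃ g : A → List A, IsBLSP g ∧ ∀ x ∈ D, f x = g x

/-- The episturmian morphism `L_α`. -/
def Lmor [DecidableEq A] (α : A) : A → List A := fun β => if β = α then [α] else [α, β]

/-- `u` is an `(a,b,c,β,γ)`-fragility of `w`. -/
def Frag5 (w : ℕ → A) (a b c β γ : A) (u : List A) : Prop :=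
  IsPrefixI (u ++ [a]) w ∧ IsFactorI (β :: (u ++ [b])) w ∧ IsFactorI (γ :: (u ++ [c])) w

/-- `w` is `(a,b,c)`-fragile. -/
def Fragile (w : ℕ → A) (a b c : A) : Prop :=
  ∃ (u : List A) (β γ : A), β ≠ γ ∧ Frag5 w a b c β γ u

/-- `f` is LSP `(a,b,c)`-breaking (for words over the domain `D` of `f`). -/
def Breaking (D : Set A) (f : A → List A) (a b c : A) : Prop :=
  ∀ (w x : ℕ → A), Set.range w ⊆ D → IsLSP w → Fragile w a b c →
    InfImage f w x → ¬ IsLSP x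

/-- Length of the longest common prefix of two finite words. -/
noncomputable def lcpLen (u v : List A) : ℕ :=
  sSup {n | n ≤ u.length ∧ n ≤ v.length ∧ u.take n = v.take n}

/-- A morphism is nonerasing if images of letters are nonempty. -/
def Nonerasing (f : A → List B) : Prop := ∀ a : A, f a ≠ []

/-- `f` preserves the LSP property for infinite words. -/
def PreservesLSP (f : A → List B) : Prop :=
  ∀ (w : ℕ → A) (x : ℕ → B), IsLSP w → InfImage f w x → IsLSP x

/-- `f ∈ U(A,B)`: nonerasing and each letter of `B` occurs at most once in total
among the images of letters. -/
def InU [Fintype A] [DecidableEq B] (f : A → List B) : Prop :=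
  Nonerasing f ∧ ∀ b : B, (∑ a : A, (f a).count b) ≤ 1

/-- `u^k`. -/
def listPow (u : List B) (k : ℕ) : List B := (List.replicate k u).flatten

/-- `x = u^ω`. -/
def IsOmegaPow (u : List B) (x : ℕ → B) : Prop := ∀ k : ℕ, IsPrefixI (listPow u k) x

/-- `f ∈ P_LSP(A,B)`: nonerasing, all images are positive powers of a word `u`
with `u^ω` LSP. -/
def InPLSP (f : A → List B) : Prop :=
  Nonerasing f ∧ ∃ u : List B, u ≠ [] ∧ (∀ a : A, ∃ k : ℕ, 0 < k ∧ f a = listPow u k) ∧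
    ∀ x : ℕ → B, IsOmegaPow u x → IsLSP x

/-- `r` is the primitive root of `w`. -/
def IsPrimRoot (r w : List B) : Prop :=
  (∃ k : ℕ, 0 < k ∧ w = listPow r k) ∧
  ∀ (v : List B) (k : ℕ), 0 < k → w = listPow v k → r.length ≤ v.length

/-- Compatibility of a chain of morphisms `[g_1, …, g_n]` (composition
`g_1 ∘ ⋯ ∘ g_n`): every letter produced by `g_{i+1}` lies in the domain of `g_i`. -/
def CompatChain (L : List (B → List B)) : Prop :=
  List.Chain' (fun g h => ∀ x y, y ∈ h x → g y ≠ []) L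

end LSPDefs


section LSPProof

variable {A : Type*}

theorem isLSP_iff (w : ℕ → A) : IsLSP w ↔ ∀ m m' n : ℕ, w m ≠ w m' →
    (∀ i < n, w (m + 1 + i) = w (m' + 1 + i)) → ∀ i < n, w i = w (m + 1 + i) := by
  constructor
  · intro h m m' n hne heq i hi
    have := h (List.ofFn (fun i : Fin n => w (m + 1 + i))) ⟨w m, w m', hne, ⟨m, ?_⟩, ⟨m', ?_⟩⟩ i
      (by simpa using hi)
    · simpa using this.symm
    · rintro (_ | j) hj
      · simp
      · simp; congr 1; omega
    · rintro (_ | j) hj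
      · simp
      · simp at hj
        simp; rw [heq j hj]; congr 1; omega
  · rintro h u ⟨a, b, hab, ⟨m, hm⟩, ⟨m', hm'⟩⟩ i hi
    have h1 := hm 0 (by simp)
    have h2 := hm' 0 (by simp)
    simp at h1 h2
    have h3 : ∀ i (hi : i < u.length), u[i] = w (m + 1 + i) := by
      intro i hi
      have := hm (i+1) (by simpa using hi)
      simp at this
      rw [this]; congr 1; omega
    have h4 : ∀ i (hi : i < u.length), u[i] = w (m' + 1 + i) := by
      intro i hi
      have := hm' (i+1) (by simpa using hi)
      simp at this
      rw [this]; congr 1; omega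
    have := h m m' u.length (by rw [← h1, ← h2]; exact hab)
      (fun i hi => by rw [← h3 i hi, ← h4 i hi]) i hi
    simp [this, h3 i hi]

theorem fragile_iff (w : ℕ → A) (a b c : A) : Fragile w a b c ↔ ∃ n m m' : ℕ, w m ≠ w m' ∧
    (∀ i < n, w i = w (m + 1 + i)) ∧ (∀ i < n, w i = w (m' + 1 + i)) ∧
    w n = a ∧ w (m + 1 + n) = b ∧ w (m' + 1 + n) = c := by
  constructor
  · rintro ⟨u, β, γ, hne, hp, ⟨m, hm⟩, ⟨m', hm'⟩⟩
    have key : ∀ (k : ℕ) (β b : A), (∀ (i : ℕ) (h : i < (β :: (u ++ [b])).length),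
        (β :: (u ++ [b])).get ⟨i, h⟩ = w (k + i)) →
        β = w k ∧ (∀ i (hi : i < u.length), u[i] = w (k + 1 + i)) ∧
          b = w (k + 1 + u.length) := by
      intro k β b hk
      refine ⟨by simpa using hk 0 (by simp), ?_, ?_⟩
      · intro i hi
        have := hk (i+1) (by simp; omega)
        simp [List.getElem_append, hi] at this
        rw [this]; congr 1; omega
      · have := hk (u.length+1) (by simp)
        simp at this
        rw [this]; congr 1; omega
    obtain ⟨h1, h2, h3⟩ := key m β b hm
    obtain ⟨h4, h5, h6⟩ := key m' γ c hm'
    have h7 : ∀ i (hi : i < u.length), u[i] = w i := by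
      intro i hi
      have := hp i (by simp; omega)
      simpa [List.getElem_append, hi] using this
    have h8 := hp u.length (by simp)
    simp at h8
    refine ⟨u.length, m, m', by rw [← h1, ← h4]; exact hne, ?_, ?_, h8.symm, h3.symm, h6.symm⟩
    · intro i hi; rw [← h7 i hi, ← h2 i hi]
    · intro i hi; rw [← h7 i hi, ← h5 i hi]
  · rintro ⟨n, m, m', hne, h1, h2, ha, hb, hc⟩
    have key : ∀ (k : ℕ) (b : A), (∀ i < n, w i = w (k + 1 + i)) → w (k + 1 + n) = b →
        IsFactorI (w k :: (List.ofFn (fun i : Fin n => w i) ++ [b])) w := by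
      intro k b h hb
      refine ⟨k, ?_⟩
      rintro (_ | j) hj
      · simp
      · simp at hj
        by_cases hjn : j < n
        · simp [List.getElem_append, hjn, h j hjn]
          congr 1; omega
        · have : j = n := by omega
          subst this
          simp [List.getElem_append, ← hb]
          congr 1; omega
    refine ⟨List.ofFn (fun i : Fin n => w i), w m, w m', hne, ?_, key m b h1 hb, key m' c h2 hc⟩
    intro i hi
    simp at hi
    by_cases hin : i < n
    · simp [List.getElem_append, hin]
    · have : i = n := by omega
      subst this
      simp [List.getElem_append, ha]

theorem le_lcpLen_iff (u v : List A) (n : ℕ) : n ≤ lcpLen u v ↔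
    n ≤ u.length ∧ n ≤ v.length ∧ ∀ i < n, u[i]? = v[i]? := by
  have hset : ∀ n, (n ≤ u.length ∧ n ≤ v.length ∧ u.take n = v.take n) ↔
      (n ≤ u.length ∧ n ≤ v.length ∧ ∀ i < n, u[i]? = v[i]?) := by
    intro n
    refine and_congr_right fun _ => and_congr_right fun _ => ?_
    constructor
    · intro h i hi
      have := congrArg (fun l => l[i]?) h
      simpa [List.getElem?_take, hi] using this
    · intro h
      apply List.ext_getElem?
      intro i
      by_cases hi : i < n
      · simp [List.getElem?_take, hi, h i hi]
      · simp [List.getElem?_take, hi]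
  have hb : BddAbove {n | n ≤ u.length ∧ n ≤ v.length ∧ u.take n = v.take n} :=
    ⟨u.length, fun n hn => hn.1⟩
  constructor
  · intro h
    have hm := Nat.sSup_mem (s := {n | n ≤ u.length ∧ n ≤ v.length ∧ u.take n = v.take n})
      ⟨0, by simp⟩ hb
    have hm' := (hset _).1 hm
    change n ≤ sSup _ at h
    exact ⟨h.trans hm'.1, h.trans hm'.2.1, fun i hi => hm'.2.2 i (by omega)⟩
  · intro h
    exact le_csSup hb ((hset n).2 h)

/-- Structure of a bLSP morphism. -/
theorem blsp_struct (g : A → List A) (hg : IsBLSP g) :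
    (∀ y, g y ≠ []) ∧ (∀ y, (g y)[(g y).length - 1]? = some y) ∧
    (∀ y i z, (g y)[i]? = some z → g z = (g y).take (i+1)) := by
  obtain ⟨α, hα, h⟩ := hg
  refine ⟨?_, ?_, ?_⟩
  · intro y hy
    by_cases hya : y = α
    · subst hya; simp [hα] at hy
    · obtain ⟨γ, hγ⟩ := h y hya
      simp [hγ] at hy
  · intro y
    by_cases hya : y = α
    · subst hya; simp [hα]
    · obtain ⟨γ, hγ⟩ := h y hya
      simp [hγ]
  · have : ∀ N y, (g y).length = N → ∀ i z, (g y)[i]? = some z → g z = (g y).take (i+1) := by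
      intro N
      induction N with
      | zero =>
        intro y hy i z hz
        have : g y = [] := List.length_eq_zero_iff.1 hy
        simp [this] at hz
      | succ N ih =>
        intro y hy i z hz
        by_cases hya : y = α
        · subst hya
          rw [hα] at hz
          have : i = 0 := by
            by_contra hi
            obtain ⟨j, rfl⟩ := Nat.exists_eq_succ_of_ne_zero hi
            simp at hz
          subst this
          simp at hz
          subst hz
          simp [hα]
        · obtain ⟨γ, hγ⟩ := h y hya
          have hl : (g γ).length = N := by
            rw [hγ] at hy; simpa using hy
          by_cases hi : i < (g γ).length
          · rw [hγ, List.getElem?_append_left hi] at hz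
            rw [ih γ hl i z hz, hγ, List.take_append_of_le_length (by omega)]
          · have hi2 : i < (g y).length := by
              by_contra hc
              rw [List.getElem?_eq_none (by omega)] at hz
              simp at hz
            have : i = N := by omega
            subst this
            rw [hγ, ← hl] at hz
            simp at hz
            subst hz
            rw [List.take_of_length_le (by omega)]
    exact fun y => this _ y rfl

/-- Starting position of the `n`-th block. -/
def bpos (g : A → List A) (w : ℕ → A) (n : ℕ) : ℕ := (applyM g (infPrefix w n)).length

theorem applyM_succ (g : A → List A) (w : ℕ → A) (n : ℕ) :
    applyM g (infPrefix w (n+1)) = applyM g (infPrefix w n) ++ g (w n) := by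
  unfold applyM infPrefix
  rw [List.ofFn_succ']
  simp [List.concat_eq_append]

theorem bpos_zero (g : A → List A) (w : ℕ → A) : bpos g w 0 = 0 := by
  simp [bpos, applyM, infPrefix]

theorem bpos_succ (g : A → List A) (w : ℕ → A) (n : ℕ) :
    bpos g w (n+1) = bpos g w n + (g (w n)).length := by
  simp [bpos, applyM_succ]

theorem img_get (g : A → List A) (w x : ℕ → A) (hx : InfImage g w x) (n i : ℕ)
    (hi : i < (g (w n)).length) : (g (w n))[i]? = some (x (bpos g w n + i)) := by
  have := hx (n+1) (bpos g w n + i) (by rw [applyM_succ]; simp [bpos, hi])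
  rw [← this]
  simp [applyM_succ, bpos, List.getElem_append, hi]

theorem bpos_shift (g : A → List A) (w : ℕ → A) (m m' n : ℕ)
    (h : ∀ i < n, w (m + i) = w (m' + i)) :
    bpos g w (m + n) + bpos g w m' = bpos g w (m' + n) + bpos g w m := by
  induction n with
  | zero => simp; omega
  | succ n ih =>
    have h1 := ih (fun i hi => h i (by omega))
    have h2 := h n (by omega)
    rw [← add_assoc, ← add_assoc, bpos_succ, bpos_succ, h2]
    omega

theorem bpos_ge (g : A → List A) (w : ℕ → A) (hne : ∀ y, g y ≠ []) (m n : ℕ) :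
    bpos g w m + n ≤ bpos g w (m + n) := by
  induction n with
  | zero => simp
  | succ n ih =>
    rw [← add_assoc m, bpos_succ]
    have := List.length_pos_iff.2 (hne (w (m+n)))
    omega

theorem exists_block (g : A → List A) (w : ℕ → A) (hne : ∀ y, g y ≠ []) (k : ℕ) :
    ∃ n i, k = bpos g w n + i ∧ i < (g (w n)).length := by
  induction k with
  | zero => exact ⟨0, 0, by simp [bpos_zero], List.length_pos_iff.2 (hne _)⟩
  | succ k ih =>
    obtain ⟨n, i, hk, hi⟩ := ih
    by_cases h : i + 1 < (g (w n)).length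
    · exact ⟨n, i+1, by omega, h⟩
    · exact ⟨n+1, 0, by rw [bpos_succ]; omega, List.length_pos_iff.2 (hne _)⟩

theorem img_len (g : A → List A) (hg : IsBLSP g) (w x : ℕ → A) (hx : InfImage g w x) (n i : ℕ)
    (hi : i < (g (w n)).length) : (g (x (bpos g w n + i))).length = i + 1 := by
  rw [(blsp_struct g hg).2.2 _ _ _ (img_get g w x hx n i hi)]
  simp; omega

theorem img_last (g : A → List A) (hg : IsBLSP g) (w x : ℕ → A) (hx : InfImage g w x) (n : ℕ) :
    x (bpos g w n + ((g (w n)).length - 1)) = w n := by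
  have h0 := List.length_pos_iff.2 ((blsp_struct g hg).1 (w n))
  have h := img_get g w x hx n ((g (w n)).length - 1) (by omega)
  rw [(blsp_struct g hg).2.1] at h
  exact (Option.some.inj h).symm

/-- The predecessor of a non-root letter is determined. -/
theorem img_pred (g : A → List A) (hg : IsBLSP g) (w x : ℕ → A) (hx : InfImage g w x) (k : ℕ)
    (hk : (g (x (k+1))).length ≠ 1) :
    some (x k) = (g (x (k+1)))[(g (x (k+1))).length - 2]? := by
  obtain ⟨n, i, hki, hi⟩ := exists_block g w (blsp_struct g hg).1 (k+1)
  have hl := img_len g hg w x hx n i hi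
  rw [← hki] at hl
  have hi0 : 0 < i := by omega
  have h1 := img_get g w x hx n (i-1) (by omega)
  have h2 := (blsp_struct g hg).2.2 _ _ _ (img_get g w x hx n i hi)
  rw [← hki] at h2
  have : bpos g w n + (i - 1) = k := by omega
  rw [this] at h1
  rw [hl, h2, ← h1, List.getElem?_take]
  rw [if_pos (by omega)]
  congr 1

/-- Left-special start of block. -/
theorem img_start (g : A → List A) (hg : IsBLSP g) (w x : ℕ → A) (hx : InfImage g w x) (k : ℕ)
    (hk : (g (x (k+1))).length = 1) : ∃ m, bpos g w (m+1) = k + 1 ∧ w m = x k := by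
  obtain ⟨n, i, hki, hi⟩ := exists_block g w (blsp_struct g hg).1 (k+1)
  have hl := img_len g hg w x hx n i hi
  rw [← hki] at hl
  have hi0 : i = 0 := by omega
  subst hi0
  rcases n with _ | m
  · simp [bpos_zero] at hki
  · refine ⟨m, by omega, ?_⟩
    rw [← img_last g hg w x hx m]
    congr 1
    rw [bpos_succ] at hki
    have h0 := List.length_pos_iff.2 ((blsp_struct g hg).1 (w m))
    omega

theorem img_agree (g : A → List A) (hg : IsBLSP g) (w x : ℕ → A) (hx : InfImage g w x)
    (m m' n : ℕ) (h : ∀ i < n, w (m + i) = w (m' + i)) (i : ℕ)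
    (hi : bpos g w m + i < bpos g w (m + n)) : x (bpos g w m + i) = x (bpos g w m' + i) := by
  induction n with
  | zero => simp at hi
  | succ n ih =>
    have hs := bpos_shift g w m m' n (fun i hi => h i (by omega))
    have hn := h n (by omega)
    have hge := bpos_ge g w (blsp_struct g hg).1 m n
    by_cases hc : bpos g w m + i < bpos g w (m + n)
    · exact ih (fun i hi => h i (by omega)) hc
    · rw [← add_assoc, bpos_succ] at hi
      obtain ⟨j, hj⟩ : ∃ j, bpos g w m + i = bpos g w (m + n) + j :=
        ⟨bpos g w m + i - bpos g w (m + n), by omega⟩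
      have h1 := img_get g w x hx (m+n) j (by omega)
      have h2 := img_get g w x hx (m'+n) j (by rw [← hn]; omega)
      rw [hn, h2] at h1
      have h3 := Option.some.inj h1
      rw [hj, ← h3]
      congr 1; omega

theorem breaking_core (g : A → List A) (hg : IsBLSP g) (w x : ℕ → A) (hx : InfImage g w x)
    (a b c : A) (hfr : Fragile w a b c) (hlcp : lcpLen (g a) (g b) < lcpLen (g b) (g c)) :
    ¬ IsLSP x := by
  intro hL
  rw [fragile_iff] at hfr
  obtain ⟨n, m, m', hne, h1, h2, rfl, rfl, rfl⟩ := hfr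
  rw [isLSP_iff] at hL
  have hpos := fun y => List.length_pos_iff.2 ((blsp_struct g hg).1 y)
  set j := lcpLen (g (w n)) (g (w (m+1+n))) with hj
  obtain ⟨hb, hc, hbc⟩ := (le_lcpLen_iff _ _ _).1 (Nat.succ_le_of_lt hlcp)
  have s1 := bpos_shift g w 0 (m+1) n (by simpa using h1)
  have s2 := bpos_shift g w 0 (m'+1) n (by simpa using h2)
  simp [bpos_zero] at s1 s2
  set q := bpos g w n
  have e1 := img_last g hg w x hx m
  have e2 := img_last g hg w x hx m'
  have p1 := hpos (w m)
  have p2 := hpos (w m')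
  have b1 := bpos_succ g w m
  have b2 := bpos_succ g w m'
  have key := hL (bpos g w m + ((g (w m)).length - 1)) (bpos g w m' + ((g (w m')).length - 1))
    (q + (j + 1)) (by rw [e1, e2]; exact hne) ?_
  · have key2 : ∀ i < q + (j+1), x i = x (bpos g w (m+1) + i) := by
      intro i hi
      rw [key i hi]; congr 1; omega
    have key3 : ∀ i < j + 1, some (x (q + i)) = (g (w (m+1+n)))[i]? := by
      intro i hi
      rw [img_get g w x hx (m+1+n) i (by omega), key2 (q+i) (by omega)]
      congr 2; omega
    by_cases hja : j < (g (w n)).length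
    · have : j + 1 ≤ j := by
        nth_rewrite 2 [hj]
        rw [le_lcpLen_iff]
        refine ⟨hja, hb, fun i hi => ?_⟩
        rw [← key3 i hi, img_get g w x hx n i (by omega)]
      omega
    · have h3 := key2 (q + (g (w n)).length) (by omega)
      have h4 := img_len g hg w x hx (n+1) 0 (hpos _)
      rw [bpos_succ, add_zero] at h4
      have h5 := img_len g hg w x hx (m+1+n) (g (w n)).length (by omega)
      have h6 : bpos g w (m+1+n) + (g (w n)).length =
        bpos g w (m+1) + (q + (g (w n)).length) := by omega
      rw [h6, ← h3, h4] at h5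
      have := hpos (w n)
      omega
  · intro i hi
    have t1 : bpos g w m + ((g (w m)).length - 1) + 1 + i = bpos g w (m+1) + i := by omega
    have t2 : bpos g w m' + ((g (w m')).length - 1) + 1 + i = bpos g w (m'+1) + i := by omega
    rw [t1, t2]
    by_cases hiq : i < q
    · exact img_agree g hg w x hx (m+1) (m'+1) n
        (fun i hi => by rw [← h1 i hi, ← h2 i hi]) i (by omega)
    · obtain ⟨r, rfl⟩ := Nat.exists_eq_add_of_le (not_lt.1 hiq)
      have u1 := img_get g w x hx (m+1+n) r (by omega)
      have u2 := img_get g w x hx (m'+1+n) r (by omega)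
      rw [hbc r (by omega), u2] at u1
      have := Option.some.inj u1
      have v1 : bpos g w (m+1) + (q + r) = bpos g w (m+1+n) + r := by omega
      have v2 : bpos g w (m'+1) + (q + r) = bpos g w (m'+1+n) + r := by omega
      rw [v1, v2, this]

theorem fragile_core (g : A → List A) (hg : IsBLSP g) (w x : ℕ → A) (hx : InfImage g w x)
    (hw : IsLSP w) (hL : ¬ IsLSP x) :
    ∃ a b c : A, a ≠ b ∧ b ≠ c ∧ a ≠ c ∧ Fragile w a b c ∧
        lcpLen (g a) (g b) < lcpLen (g b) (g c) := by
  have hne0 := (blsp_struct g hg).1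
  have hpos := fun y => List.length_pos_iff.2 (hne0 y)
  rw [isLSP_iff] at hL hw
  push Not at hL
  obtain ⟨k, k', N, hkk, hag, i0, hi0, hmis⟩ := hL
  have hag0 := hag 0 (by omega)
  simp at hag0
  have hst : (g (x (k+1))).length = 1 := by
    by_contra hc
    have h1 := img_pred g hg w x hx k hc
    have h2 := img_pred g hg w x hx k' (by rwa [← hag0])
    rw [← hag0, ← h1] at h2
    exact hkk (Option.some.inj h2).symm
  obtain ⟨m, hm, hwm⟩ := img_start g hg w x hx k hst
  obtain ⟨m', hm', hwm'⟩ := img_start g hg w x hx k' (by rwa [← hag0])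
  rw [← hwm, ← hwm'] at hkk
  rw [← hm] at hmis
  rw [← hm, ← hm'] at hag
  -- maximal n
  let Q : ℕ → Prop := fun n => (∀ i < n, w (m+1+i) = w (m'+1+i)) ∧
    bpos g w (m+1+n) ≤ bpos g w (m+1) + i0
  obtain ⟨n, ⟨hn1, hn2⟩, hmax⟩ : ∃ n, Q n ∧ ¬ Q (n+1) := by
    by_contra hcon
    push Not at hcon
    have : ∀ n, Q n := by
      intro n
      induction n with
      | zero => exact ⟨by simp, by simp⟩
      | succ n ih => exact hcon n ih
    have h1 := (this (i0+1)).2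
    have h2 := bpos_ge g w hne0 (m+1) (i0+1)
    omega
  have hpre := hw m m' n hkk hn1
  have hpre' : ∀ i < n, w i = w (m'+1+i) := fun i hi => by rw [hpre i hi, hn1 i hi]
  have s1 := bpos_shift g w 0 (m+1) n (by simpa using hpre)
  have s2 := bpos_shift g w 0 (m'+1) n (by simpa using hpre')
  simp [bpos_zero] at s1 s2
  obtain ⟨j, hj⟩ : ∃ j, i0 = bpos g w n + j := Nat.exists_eq_add_of_le (by omega)
  have hag' : ∀ i ≤ j, x (bpos g w (m+1+n) + i) = x (bpos g w (m'+1+n) + i) := by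
    intro i hi
    have := hag (bpos g w n + i) (by omega)
    have v1 : bpos g w (m+1) + (bpos g w n + i) = bpos g w (m+1+n) + i := by omega
    have v2 : bpos g w (m'+1) + (bpos g w n + i) = bpos g w (m'+1+n) + i := by omega
    rwa [v1, v2] at this
  have hlenb := hpos (w (m+1+n))
  have hlenc := hpos (w (m'+1+n))
  have hjbc : j < (g (w (m+1+n))).length ∧ j < (g (w (m'+1+n))).length := by
    rcases lt_trichotomy (g (w (m+1+n))).length (g (w (m'+1+n))).length with h | h | h
    · suffices j < (g (w (m+1+n))).length by omega
      by_contra hc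
      have h1 := hag' (g (w (m+1+n))).length (by omega)
      have h2 := img_len g hg w x hx (m+1+n+1) 0 (hpos _)
      rw [bpos_succ, add_zero] at h2
      have h3 := img_len g hg w x hx (m'+1+n) (g (w (m+1+n))).length (by omega)
      rw [← h1, h2] at h3
      omega
    · suffices j < (g (w (m+1+n))).length by omega
      by_contra hc
      have h1 := hag' ((g (w (m+1+n))).length - 1) (by omega)
      rw [img_last g hg w x hx, h, img_last g hg w x hx] at h1
      apply hmax
      refine ⟨fun i hi => ?_, ?_⟩
      · rcases Nat.lt_succ_iff_lt_or_eq.1 hi with h | h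
        · exact hn1 i h
        · rw [h, h1]
      · rw [← add_assoc, bpos_succ]; omega
    · suffices j < (g (w (m'+1+n))).length by omega
      by_contra hc
      have h1 := hag' (g (w (m'+1+n))).length (by omega)
      have h2 := img_len g hg w x hx (m'+1+n+1) 0 (hpos _)
      rw [bpos_succ, add_zero] at h2
      have h3 := img_len g hg w x hx (m+1+n) (g (w (m'+1+n))).length (by omega)
      rw [h1, h2] at h3
      omega
  obtain ⟨hjb, hjc⟩ := hjbc
  have gb := img_get g w x hx (m+1+n) j hjb
  have gc := img_get g w x hx (m'+1+n) j hjc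
  have hmis' : x (bpos g w n + j) ≠ x (bpos g w (m+1+n) + j) := by
    rw [← hj]
    have : bpos g w (m+1+n) + j = bpos g w (m+1) + i0 := by omega
    rw [this]; exact hmis
  have hda : j < (g (w n)).length → (g (w n))[j]? ≠ (g (w (m+1+n)))[j]? := by
    intro h he
    rw [gb, img_get g w x hx n j h] at he
    exact hmis' (Option.some.inj he)
  have hgbc : (g (w (m+1+n)))[j]? = (g (w (m'+1+n)))[j]? := by
    rw [gb, gc, hag' j le_rfl]
  have hab : w n ≠ w (m+1+n) := by
    intro h
    exact hda (by rw [h]; exact hjb) (by rw [h])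
  have hac : w n ≠ w (m'+1+n) := by
    intro h
    exact hda (by rw [h]; exact hjc) (by rw [h, hgbc])
  refine ⟨w n, w (m+1+n), w (m'+1+n), hab, ?_, hac, ?_, ?_⟩
  · intro h
    refine hab (hw m m' (n+1) hkk (fun i hi => ?_) n (by omega))
    rcases Nat.lt_succ_iff_lt_or_eq.1 hi with h' | h'
    · exact hn1 i h'
    · rw [h', h]
  · rw [fragile_iff]
    exact ⟨n, m, m', hkk, hpre, hpre', rfl, rfl, rfl⟩
  · have h1 : j + 1 ≤ lcpLen (g (w (m+1+n))) (g (w (m'+1+n))) := by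
      rw [le_lcpLen_iff]
      refine ⟨hjb, hjc, fun i hi => ?_⟩
      rw [img_get g w x hx _ i (by omega), img_get g w x hx _ i (by omega), hag' i (by omega)]
    have h2 : ¬ (j + 1 ≤ lcpLen (g (w n)) (g (w (m+1+n)))) := by
      rw [le_lcpLen_iff]
      rintro ⟨h3, _, h4⟩
      exact hda h3 (h4 j (by omega))
    omega

theorem infImage_congr (f g : A → List A) (w x : ℕ → A) (h : ∀ n, f (w n) = g (w n))
    (hx : InfImage f w x) : InfImage g w x := by
  intro n
  have : applyM g (infPrefix w n) = applyM f (infPrefix w n) := by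
    unfold applyM infPrefix
    congr 1
    apply List.map_congr_left
    intro y hy
    rw [List.mem_ofFn] at hy
    obtain ⟨i, rfl⟩ := hy
    exact (h i).symm
  rw [this]
  exact hx n

theorem fragile_mem (w : ℕ → A) (a b c : A) (h : Fragile w a b c) :
    a ∈ Set.range w ∧ b ∈ Set.range w ∧ c ∈ Set.range w := by
  rw [fragile_iff] at h
  obtain ⟨n, m, m', -, -, -, rfl, rfl, rfl⟩ := h
  exact ⟨⟨_, rfl⟩, ⟨_, rfl⟩, ⟨_, rfl⟩⟩

end LSPProof

/-- for an infinite LSP word `w` and an R-bLSP morphism `f` defined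
exactly on `alph(w)`, with `x = f(w)`: `x` is not LSP iff `w` is `(a,b,c)`-fragile
for letters with the lcp condition, iff `w` is `(a,b,c)`-fragile with `f`
LSP `(a,b,c)`-breaking. -/
theorem not_lsp_iff_fragile_breaking {A : Type*} (f : A → List A) (w x : ℕ → A)
    (hw : IsLSP w) (hf : IsRBLSPOn (Set.range w) f) (hx : InfImage f w x) :
    ((¬ IsLSP x) ↔ (∃ a b c : A, a ≠ b ∧ b ≠ c ∧ a ≠ c ∧ Fragile w a b c ∧
        lcpLen (f a) (f b) < lcpLen (f b) (f c))) ∧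
    ((∃ a b c : A, a ≠ b ∧ b ≠ c ∧ a ≠ c ∧ Fragile w a b c ∧
        lcpLen (f a) (f b) < lcpLen (f b) (f c)) ↔
      (∃ a b c : A, a ≠ b ∧ b ≠ c ∧ a ≠ c ∧ Fragile w a b c ∧
        Breaking (Set.range w) f a b c)) := by
  obtain ⟨-, g, hg, hfg⟩ := hf
  have hxg : InfImage g w x := infImage_congr f g w x (fun n => hfg _ ⟨n, rfl⟩) hx
  have h12 : (¬ IsLSP x) → (∃ a b c : A, a ≠ b ∧ b ≠ c ∧ a ≠ c ∧ Fragile w a b c ∧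
      lcpLen (f a) (f b) < lcpLen (f b) (f c)) := by
    intro h
    obtain ⟨a, b, c, h1, h2, h3, h4, h5⟩ := fragile_core g hg w x hxg hw h
    obtain ⟨ha, hb, hc⟩ := fragile_mem w a b c h4
    refine ⟨a, b, c, h1, h2, h3, h4, ?_⟩
    rw [hfg a ha, hfg b hb, hfg c hc]
    exact h5
  have h23 : (∃ a b c : A, a ≠ b ∧ b ≠ c ∧ a ≠ c ∧ Fragile w a b c ∧
        lcpLen (f a) (f b) < lcpLen (f b) (f c)) →
      (∃ a b c : A, a ≠ b ∧ b ≠ c ∧ a ≠ c ∧ Fragile w a b c ∧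
        Breaking (Set.range w) f a b c) := by
    rintro ⟨a, b, c, h1, h2, h3, h4, h5⟩
    obtain ⟨ha, hb, hc⟩ := fragile_mem w a b c h4
    rw [hfg a ha, hfg b hb, hfg c hc] at h5
    refine ⟨a, b, c, h1, h2, h3, h4, ?_⟩
    intro w' x' hD _ hfr hx'
    exact breaking_core g hg w' x'
      (infImage_congr f g w' x' (fun n => hfg _ (hD ⟨n, rfl⟩)) hx') a b c hfr h5
  have h31 : (∃ a b c : A, a ≠ b ∧ b ≠ c ∧ a ≠ c ∧ Fragile w a b c ∧
        Breaking (Set.range w) f a b c) → ¬ IsLSP x := by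
    rintro ⟨a, b, c, -, -, -, h4, h5⟩
    exact h5 w x subset_rfl hw h4 hx
  exact ⟨⟨h12, fun h => h31 (h23 h)⟩, ⟨h23, fun h => h12 (h31 h)⟩⟩
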